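/- arXiv:1209.0001 — 2 statements merged into one kernel-verified Lean document; each statement's English description precedes it below -/
import Mathlib

section
/- Assume ‖v_i‖ ≤ 1 for all i, λ_r > 0, and λ̂_r > 0. Then the Frobenius-norm difference between the Nyström approximation and the best rank-r approximation satisfies ‖K̂_r − K_r‖_F ≤ √(λ₁ N) · ‖ΔH‖₂ ≤ N · ‖ΔH‖₂, where ΔH = H_r − Ĥ_r and ‖ΔH‖₂ is the operator norm of ΔH on H. -/
open Matrix
open scoped RealInnerProductSpace

/-- The Frobenius norm of a real matrix. -/
noncomputable def frobNorm {p q : Type*} [Fintype p] [Fintype q] (A : Matrix p q ℝ) : ℝ :=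
  Real.sqrt (∑ i, ∑ j, (A i j) ^ 2)

/-- The normalized eigenfunction `φ_j = λ_j^{-1/2} Σ_i V_{i,j} v_i` (also used for the
subsampled eigenfunctions `φ̂_j = λ̂_j^{-1/2} Σ_i U_{i,j} ŵ_i`). -/
noncomputable def phiVec {H : Type*} [NormedAddCommGroup H] [InnerProductSpace ℝ H]
    {n : ℕ} (v : Fin n → H) (lam : Fin n → ℝ) (V : Matrix (Fin n) (Fin n) ℝ)
    (j : Fin n) : H :=
  (Real.sqrt (lam j))⁻¹ • ∑ i, V i j • v i

/-- The rank-`r` projection-like operator `f ↦ Σ_{i=1}^r ⟨φ_i, f⟩ φ_i`. -/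
noncomputable def projOp {H : Type*} [NormedAddCommGroup H] [InnerProductSpace ℝ H]
    {n : ℕ} (φ : Fin n → H) (r : ℕ) : H →L[ℝ] H :=
  ∑ i ∈ Finset.univ.filter (fun i : Fin n => (i : ℕ) < r), (innerSL ℝ (φ i)).smulRight (φ i)

/-- The matrix `W = Σ_{k=1}^r λ_k⁻¹ V_{·,k} V_{·,k}ᵀ` (also used for `Ŵ`). -/
noncomputable def rankW {n : ℕ} (lam : Fin n → ℝ) (V : Matrix (Fin n) (Fin n) ℝ) (r : ℕ) :
    Matrix (Fin n) (Fin n) ℝ :=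
  Matrix.of fun i j =>
    ∑ k ∈ Finset.univ.filter (fun k : Fin n => (k : ℕ) < r), (lam k)⁻¹ * V i k * V j k

/-- A Nyström matrix entry is the bilinear form of the operator `projOp` on the sections. -/
lemma mul_rankW_mul_transpose_apply {H : Type*} [NormedAddCommGroup H] [InnerProductSpace ℝ H]
    {ι : Type*} {n : ℕ} (v : ι → H) (w : Fin n → H) (B : Matrix ι (Fin n) ℝ)
    (hB : ∀ i a, B i a = ⟪v i, w a⟫) (lam : Fin n → ℝ) (U : Matrix (Fin n) (Fin n) ℝ) (r : ℕ)
    (hlam : ∀ k : Fin n, (k : ℕ) < r → 0 ≤ lam k) (i j : ι) :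
    (B * rankW lam U r * Bᵀ) i j = ⟪v i, projOp (phiVec w lam U) r (v j)⟫ := by
  have hL : (B * rankW lam U r * Bᵀ) i j =
      ∑ k ∈ Finset.univ.filter (fun k : Fin n => (k : ℕ) < r),
        (lam k)⁻¹ * ((∑ a, U a k * B i a) * ∑ b, U b k * B j b) := by
    simp only [Matrix.mul_apply, rankW, Matrix.of_apply, Matrix.transpose_apply,
      Finset.mul_sum, Finset.sum_mul]
    rw [Finset.sum_congr rfl fun b _ => Finset.sum_comm, Finset.sum_comm]
    refine Finset.sum_congr rfl fun k _ => ?_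
    refine Finset.sum_congr rfl fun b _ => Finset.sum_congr rfl fun a _ => ?_
    ring
  rw [hL, projOp, _root_.sum_apply, inner_sum]
  refine Finset.sum_congr rfl fun k hk => ?_
  have hk0 : 0 ≤ lam k := hlam k (Finset.mem_filter.mp hk).2
  have hphi : ∀ i, ⟪v i, phiVec w lam U k⟫ = (√(lam k))⁻¹ * ∑ a, U a k * B i a := by
    intro i
    simp [phiVec, inner_smul_right, inner_sum, hB]
  have hinv : (lam k)⁻¹ = (√(lam k))⁻¹ * (√(lam k))⁻¹ := by
    rw [← mul_inv, Real.mul_self_sqrt hk0]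
  rw [ContinuousLinearMap.smulRight_apply, innerSL_apply_apply, inner_smul_right,
    real_inner_comm (v j), hphi, hphi, hinv]
  ring

/-- If a matrix has an orthonormal eigenbasis with eigenvalues at most `L`, then its quadratic
form is bounded by `L` times the squared Euclidean norm. -/
lemma dotProduct_mulVec_le_of_eigenvalues_le {ι : Type*} [Fintype ι] [DecidableEq ι]
    {K V : Matrix ι ι ℝ} {lam : ι → ℝ} (hV : Vᵀ * V = 1)
    (heig : ∀ j, K *ᵥ (fun i => V i j) = lam j • (fun i => V i j)) {L : ℝ}
    (hL : ∀ j, lam j ≤ L) (c : ι → ℝ) : c ⬝ᵥ K *ᵥ c ≤ L * (c ⬝ᵥ c) := by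
  have hV' : V * Vᵀ = 1 := mul_eq_one_comm.mp hV
  have hKV : K * V = V * diagonal lam := by
    ext i j
    rw [mul_diagonal, mul_comm]
    exact congrFun (heig j) i
  have hK : K = V * diagonal lam * Vᵀ := by
    rw [← hKV, mul_assoc, hV', mul_one]
  have hcK : c ⬝ᵥ K *ᵥ c = (Vᵀ *ᵥ c) ⬝ᵥ diagonal lam *ᵥ (Vᵀ *ᵥ c) := by
    rw [hK, ← mulVec_mulVec, ← mulVec_mulVec, dotProduct_mulVec, ← mulVec_transpose]
  have hcc : c ⬝ᵥ c = (Vᵀ *ᵥ c) ⬝ᵥ (Vᵀ *ᵥ c) := by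
    rw [dotProduct_mulVec, ← mulVec_transpose, transpose_transpose, mulVec_mulVec, hV',
      one_mulVec]
  rw [hcK, hcc]
  simp only [dotProduct, mulVec_diagonal, Finset.mul_sum]
  refine Finset.sum_le_sum fun j _ => ?_
  nlinarith [hL j, mul_self_nonneg ((Vᵀ *ᵥ c) j)]

/-- The squared norm of a linear combination is the quadratic form of the Gram matrix. -/
lemma norm_sq_sum_smul_eq_dotProduct_mulVec {H : Type*} [NormedAddCommGroup H]
    [InnerProductSpace ℝ H] {ι : Type*} [Fintype ι] {v : ι → H} {K : Matrix ι ι ℝ}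
    (hK : ∀ i j, K i j = ⟪v i, v j⟫) (c : ι → ℝ) :
    ‖∑ i, c i • v i‖ ^ 2 = c ⬝ᵥ K *ᵥ c := by
  rw [← real_inner_self_eq_norm_sq, sum_inner]
  simp only [inner_sum, real_inner_smul_left, inner_smul_right, dotProduct, mulVec, hK,
    Finset.mul_sum]
  refine Finset.sum_congr rfl fun i _ => Finset.sum_congr rfl fun j _ => ?_
  ring

/-- A synthesis bound for a finite family of vectors implies the corresponding Bessel bound. -/
lemma sum_inner_sq_le_of_norm_sq_sum_smul_le {H : Type*} [NormedAddCommGroup H]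
    [InnerProductSpace ℝ H] {ι : Type*} [Fintype ι] {v : ι → H} {L : ℝ} (hL0 : 0 ≤ L)
    (hL : ∀ c : ι → ℝ, ‖∑ i, c i • v i‖ ^ 2 ≤ L * (c ⬝ᵥ c)) (x : H) :
    ∑ i, ⟪v i, x⟫ ^ 2 ≤ L * ‖x‖ ^ 2 := by
  set S := ∑ i, ⟪v i, x⟫ ^ 2 with hS
  have hS0 : 0 ≤ S := Finset.sum_nonneg fun i _ => sq_nonneg _
  have hy : ⟪∑ i, ⟪v i, x⟫ • v i, x⟫ = S := by
    simp [sum_inner, real_inner_smul_left, hS, sq]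
  have hyn : ‖∑ i, ⟪v i, x⟫ • v i‖ ^ 2 ≤ L * S := by
    refine (hL _).trans_eq ?_
    simp [dotProduct, hS, sq]
  have hcs : S ≤ ‖∑ i, ⟪v i, x⟫ • v i‖ * ‖x‖ := hy ▸ real_inner_le_norm _ _
  have hsq : S * S ≤ L * ‖x‖ ^ 2 * S := by
    calc S * S ≤ (‖∑ i, ⟪v i, x⟫ • v i‖ * ‖x‖) ^ 2 := by
          rw [← sq]; exact pow_le_pow_left₀ hS0 hcs 2
      _ = ‖∑ i, ⟪v i, x⟫ • v i‖ ^ 2 * ‖x‖ ^ 2 := mul_pow _ _ _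
      _ ≤ L * S * ‖x‖ ^ 2 := by gcongr
      _ = L * ‖x‖ ^ 2 * S := by ring
  rcases hS0.eq_or_lt with h | h
  · rw [← h]; positivity
  · exact le_of_mul_le_mul_right hsq h

/-- An eigenvalue of the Gram matrix of `N` vectors in the unit ball is at most `N`. -/
lemma gram_eigenvalue_le_card {H : Type*} [NormedAddCommGroup H] [InnerProductSpace ℝ H]
    {ι : Type*} [Fintype ι] {v : ι → H} (hv : ∀ i, ‖v i‖ ≤ 1) {K : Matrix ι ι ℝ}
    (hK : ∀ i j, K i j = ⟪v i, v j⟫) {l : ℝ} {c : ι → ℝ} (hc : c ⬝ᵥ c = 1)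
    (heig : K *ᵥ c = l • c) : l ≤ Fintype.card ι := by
  have hl : ‖∑ i, c i • v i‖ ^ 2 = l := by
    rw [norm_sq_sum_smul_eq_dotProduct_mulVec hK, heig, dotProduct_smul, hc, smul_eq_mul, mul_one]
  have hn : ‖∑ i, c i • v i‖ ≤ ∑ i, |c i| := by
    refine norm_sum_le_of_le _ fun i _ => ?_
    rw [norm_smul, Real.norm_eq_abs]
    exact mul_le_of_le_one_right (abs_nonneg _) (hv i)
  calc l = ‖∑ i, c i • v i‖ ^ 2 := hl.symm
    _ ≤ (∑ i, |c i|) ^ 2 := by gcongr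
    _ ≤ Fintype.card ι * ∑ i, |c i| ^ 2 := sq_sum_le_card_mul_sum_sq
    _ = Fintype.card ι := by
      rw [dotProduct] at hc
      simp only [sq, abs_mul_abs_self, hc, mul_one]

/-- assuming `‖v_i‖ ≤ 1`, `λ_r > 0` and `λ̂_r > 0`,
`‖K̂_r − K_r‖_F ≤ √(λ₁ N) ‖ΔH‖₂ ≤ N ‖ΔH‖₂` where `ΔH = H_r − Ĥ_r` and `‖ΔH‖₂` is the
operator norm of `ΔH` on `H`. -/
theorem nystrom_frobenius_le_opNorm
    {H : Type*} [NormedAddCommGroup H] [InnerProductSpace ℝ H]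
    (N m r : ℕ) (hN : 0 < N) (hr1 : 1 ≤ r) (hrN : r ≤ N) (hrm : r ≤ m)
    (v : Fin N → H) (hv : ∀ i, ‖v i‖ ≤ 1)
    (K : Matrix (Fin N) (Fin N) ℝ) (hK : ∀ i j, K i j = ⟪v i, v j⟫)
    (lam : Fin N → ℝ) (hdesc : ∀ i j : Fin N, i ≤ j → lam j ≤ lam i)
    (V : Matrix (Fin N) (Fin N) ℝ) (hV : Vᵀ * V = 1)
    (heig : ∀ j, K.mulVec (fun i => V i j) = lam j • (fun i => V i j))
    (w : Fin m → H) (hw : ∀ a, ∃ i, w a = v i)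
    (Khat : Matrix (Fin m) (Fin m) ℝ) (hKhat : ∀ a b, Khat a b = ⟪w a, w b⟫)
    (lamh : Fin m → ℝ) (hdesch : ∀ a b : Fin m, a ≤ b → lamh b ≤ lamh a)
    (U : Matrix (Fin m) (Fin m) ℝ) (hU : Uᵀ * U = 1)
    (heigh : ∀ j, Khat.mulVec (fun i => U i j) = lamh j • (fun i => U i j))
    (hlam : 0 < lam ⟨r - 1, by omega⟩) (hlamh : 0 < lamh ⟨r - 1, by omega⟩)
    (Kb : Matrix (Fin N) (Fin m) ℝ) (hKb : ∀ i a, Kb i a = ⟪v i, w a⟫) :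
    frobNorm (Kb * rankW lamh U r * Kbᵀ - K * rankW lam V r * K) ≤
        Real.sqrt (lam ⟨0, hN⟩ * N) *
          ‖projOp (phiVec v lam V) r - projOp (phiVec w lamh U) r‖ ∧
      Real.sqrt (lam ⟨0, hN⟩ * N) *
          ‖projOp (phiVec v lam V) r - projOp (phiVec w lamh U) r‖ ≤
        N * ‖projOp (phiVec v lam V) r - projOp (phiVec w lamh U) r‖ := by
  have hpos : ∀ k : Fin N, (k : ℕ) < r → 0 ≤ lam k := fun k hk =>
    hlam.le.trans (hdesc _ _ (Fin.le_def.mpr (by simp only; omega)))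
  have hposh : ∀ k : Fin m, (k : ℕ) < r → 0 ≤ lamh k := fun k hk =>
    hlamh.le.trans (hdesch _ _ (Fin.le_def.mpr (by simp only; omega)))
  have hL0 : 0 ≤ lam ⟨0, hN⟩ := hpos _ hr1
  have hLN : lam ⟨0, hN⟩ ≤ N := by
    have hc : (fun i => V i ⟨0, hN⟩) ⬝ᵥ (fun i => V i ⟨0, hN⟩) = 1 := by
      have h := congrFun (congrFun hV ⟨0, hN⟩) ⟨0, hN⟩
      rwa [Matrix.one_apply_eq] at h
    simpa using gram_eigenvalue_le_card hv hK hc (heig _)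
  set A := projOp (phiVec v lam V) r - projOp (phiVec w lamh U) r with hA
  have hbessel := sum_inner_sq_le_of_norm_sq_sum_smul_le (v := v) hL0 fun c =>
    (norm_sq_sum_smul_eq_dotProduct_mulVec hK c).trans_le
      (dotProduct_mulVec_le_of_eigenvalues_le hV heig
        (fun j => hdesc _ _ (Fin.le_def.mpr (Nat.zero_le _))) c)
  have hKt : Kᵀ = K := by
    ext i j
    rw [Matrix.transpose_apply, hK, hK, real_inner_comm]
  have hentry : ∀ i j,
      (Kb * rankW lamh U r * Kbᵀ - K * rankW lam V r * K) i j = -⟪v i, A (v j)⟫ := by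
    intro i j
    have h := mul_rankW_mul_transpose_apply v v K hK lam V r hpos i j
    rw [hKt] at h
    rw [Matrix.sub_apply, h, mul_rankW_mul_transpose_apply v w Kb hKb lamh U r hposh, hA,
      _root_.sub_apply, inner_sub_right]
    ring
  constructor
  · have hsum : ∑ i, ∑ j, ((Kb * rankW lamh U r * Kbᵀ - K * rankW lam V r * K) i j) ^ 2 ≤
        lam ⟨0, hN⟩ * N * ‖A‖ ^ 2 := by
      simp only [hentry, neg_sq]
      rw [Finset.sum_comm]
      calc ∑ j, ∑ i, ⟪v i, A (v j)⟫ ^ 2 ≤ ∑ _j : Fin N, lam ⟨0, hN⟩ * ‖A‖ ^ 2 := by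
            refine Finset.sum_le_sum fun j _ => (hbessel _).trans ?_
            gcongr
            exact A.unit_le_opNorm _ (hv j)
        _ = lam ⟨0, hN⟩ * N * ‖A‖ ^ 2 := by
            rw [Finset.sum_const, Finset.card_univ, Fintype.card_fin, nsmul_eq_mul]
            ring
    calc frobNorm _ ≤ √(lam ⟨0, hN⟩ * N * ‖A‖ ^ 2) := Real.sqrt_le_sqrt hsum
      _ = √(lam ⟨0, hN⟩ * N) * ‖A‖ := by
          rw [Real.sqrt_mul (by positivity), Real.sqrt_sq (norm_nonneg _)]
  · gcongr
    rw [Real.sqrt_le_left (Nat.cast_nonneg N), sq]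
    gcongr
end

section
/- Assume the Gram matrix K is positive definite, λ̂_r > 0, and the normalized eigengap satisfies Δ = (λ_r − λ_{r+1})/N > 3 ‖L_N − L_m‖_HS. Then the operator ΔH = H_r − Ĥ_r satisfies ‖ΔH‖₂ ≤ 4‖L_N − L_m‖_HS / (Δ − ‖L_N − L_m‖_HS) ≤ 6‖L_N − L_m‖_HS / Δ, where ‖ΔH‖₂ is the operator norm on H. -/
open Matrix
open scoped RealInnerProductSpace

/-- The Hilbert–Schmidt norm of an operator `L` on a real Hilbert space, computed in the
orthonormal basis `b` (the ℓ² norm of the matrix of `L` in any orthonormal basis). -/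
noncomputable def hsNorm {H : Type*} [NormedAddCommGroup H] [InnerProductSpace ℝ H]
    {ι : Type*} (b : HilbertBasis ι ℝ H) (L : H →L[ℝ] H) : ℝ :=
  Real.sqrt (∑' p : ι × ι, (⟪b p.1, L (b p.2)⟫ : ℝ) ^ 2)

/-- The empirical integral operator `f ↦ (1/n) Σ_i ⟨v_i, f⟩ v_i`. -/
noncomputable def integralOp {H : Type*} [NormedAddCommGroup H] [InnerProductSpace ℝ H]
    {n : ℕ} (v : Fin n → H) : H →L[ℝ] H :=
  (n : ℝ)⁻¹ • ∑ i, (innerSL ℝ (v i)).smulRight (v i)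

section OperatorBounds

variable {H : Type*} [NormedAddCommGroup H] [InnerProductSpace ℝ H]

section HilbertSchmidt

variable {ι : Type*} (b : HilbertBasis ι ℝ H)

/-- The matrix of `L` in the orthonormal basis `b` is square-summable. -/
def IsHilbertSchmidt (L : H →L[ℝ] H) : Prop :=
  Summable fun p : ι × ι => (⟪b p.1, L (b p.2)⟫ : ℝ) ^ 2

variable {b}

theorem IsHilbertSchmidt.add {L M : H →L[ℝ] H} (hL : IsHilbertSchmidt b L)
    (hM : IsHilbertSchmidt b M) : IsHilbertSchmidt b (L + M) := by
  refine Summable.of_nonneg_of_le (fun p => sq_nonneg _) (fun p => ?_)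
    ((Summable.add hL hM).mul_left 2)
  rw [_root_.add_apply, inner_add_right]
  exact add_sq_le

theorem IsHilbertSchmidt.smul {L : H →L[ℝ] H} (c : ℝ) (hL : IsHilbertSchmidt b L) :
    IsHilbertSchmidt b (c • L) := by
  refine (Summable.mul_left (c ^ 2) hL).congr fun p => ?_
  rw [_root_.smul_apply, real_inner_smul_right, mul_pow]

theorem IsHilbertSchmidt.sub {L M : H →L[ℝ] H} (hL : IsHilbertSchmidt b L)
    (hM : IsHilbertSchmidt b M) : IsHilbertSchmidt b (L - M) := by
  simpa [sub_eq_add_neg] using hL.add (hM.smul (-1))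

theorem IsHilbertSchmidt.sum {κ : Type*} (s : Finset κ) {L : κ → H →L[ℝ] H}
    (hL : ∀ k ∈ s, IsHilbertSchmidt b (L k)) : IsHilbertSchmidt b (∑ k ∈ s, L k) :=
  Finset.sum_induction _ _ (fun _ _ => IsHilbertSchmidt.add)
    (by simp [IsHilbertSchmidt, summable_zero]) hL

theorem HilbertBasis.hasSum_sq_inner (b : HilbertBasis ι ℝ H) (x : H) :
    HasSum (fun i => (⟪b i, x⟫ : ℝ) ^ 2) (‖x‖ ^ 2) := by
  have h := b.hasSum_inner_mul_inner x x
  rw [real_inner_self_eq_norm_sq] at h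
  have hfun : (fun i => (⟪b i, x⟫ : ℝ) ^ 2) = fun i => ⟪x, b i⟫ * ⟪b i, x⟫ := by
    funext i
    rw [real_inner_comm (b i) x, sq]
  rwa [hfun]

theorem isHilbertSchmidt_rankOne (u w : H) :
    IsHilbertSchmidt b ((innerSL ℝ u).smulRight w) := by
  have h := (b.hasSum_sq_inner w).summable.mul_of_nonneg (b.hasSum_sq_inner u).summable
    (fun _ => sq_nonneg _) (fun _ => sq_nonneg _)
  refine h.congr fun p => ?_
  simp only [ContinuousLinearMap.smulRight_apply, innerSL_apply_apply, real_inner_smul_right]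
  rw [real_inner_comm (b p.2) u]
  ring

theorem isHilbertSchmidt_integralOp {n : ℕ} (v : Fin n → H) :
    IsHilbertSchmidt b (integralOp v) :=
  (IsHilbertSchmidt.sum _ fun _ _ => isHilbertSchmidt_rankOne _ _).smul _

theorem opNorm_le_hsNorm {L : H →L[ℝ] H} (hL : IsHilbertSchmidt b L)
    (hsymm : ∀ x y, (⟪L x, y⟫ : ℝ) = ⟪x, L y⟫) : ‖L‖ ≤ hsNorm b L := by
  have hcol : HasSum (fun i => ‖L (b i)‖ ^ 2)
      (∑' p : ι × ι, (⟪b p.1, L (b p.2)⟫ : ℝ) ^ 2) := by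
    have h := (Equiv.prodComm ι ι).hasSum_iff.mpr (Summable.hasSum hL)
    exact h.prod_fiberwise fun i => b.hasSum_sq_inner (L (b i))
  refine L.opNorm_le_bound (Real.sqrt_nonneg _) fun x => ?_
  refine le_of_sq_le_sq ?_ (mul_nonneg (Real.sqrt_nonneg _) (norm_nonneg x))
  rw [mul_pow, hsNorm, Real.sq_sqrt (tsum_nonneg fun p => sq_nonneg _)]
  refine hasSum_le (fun i => ?_) (b.hasSum_sq_inner (L x)) (hcol.mul_right (‖x‖ ^ 2))
  rw [← hsymm, ← mul_pow, ← sq_abs]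
  exact pow_le_pow_left₀ (abs_nonneg _) (abs_real_inner_le_norm _ _) 2

end HilbertSchmidt

theorem inner_integralOp_left {n : ℕ} (v : Fin n → H) (x y : H) :
    (⟪integralOp v x, y⟫ : ℝ) = ⟪x, integralOp v y⟫ := by
  simp only [integralOp, _root_.smul_apply, _root_.sum_apply,
    ContinuousLinearMap.smulRight_apply, innerSL_apply_apply, real_inner_smul_left,
    real_inner_smul_right, sum_inner, inner_sum]
  congr 1
  refine Finset.sum_congr rfl fun i _ => ?_
  rw [real_inner_comm x (v i)]
  ring

theorem opNorm_integralOp_sub_le_hsNorm {ι : Type*} (b : HilbertBasis ι ℝ H) {n m : ℕ}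
    (v : Fin n → H) (w : Fin m → H) :
    ‖integralOp v - integralOp w‖ ≤ hsNorm b (integralOp v - integralOp w) :=
  opNorm_le_hsNorm ((isHilbertSchmidt_integralOp v).sub (isHilbertSchmidt_integralOp w))
    fun x y => by
      simp only [_root_.sub_apply, inner_sub_left, inner_sub_right, inner_integralOp_left]

/-- Pairwise orthogonal vectors, each of which is a unit vector or zero. -/
structure IsPartialOrthonormal {κ : Type*} (φ : κ → H) : Prop where
  orthogonal : ∀ i j, i ≠ j → (⟪φ i, φ j⟫ : ℝ) = 0
  unit_or_zero : ∀ i, (⟪φ i, φ i⟫ : ℝ) = 1 ∨ φ i = 0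

theorem IsPartialOrthonormal.inner_mul_inner_self {κ : Type*} {φ : κ → H}
    (hφ : IsPartialOrthonormal φ) (i : κ) (x : H) :
    (⟪φ i, x⟫ : ℝ) * ⟪φ i, φ i⟫ = ⟪φ i, x⟫ := by
  rcases hφ.unit_or_zero i with h | h
  · rw [h, mul_one]
  · simp [h]

/-- The diagonal operator `f ↦ Σ_i c_i ⟨φ_i, f⟩ φ_i`. -/
noncomputable def diagOp {κ : Type*} [Fintype κ] (φ : κ → H) (c : κ → ℝ) : H →L[ℝ] H :=
  ∑ i, c i • (innerSL ℝ (φ i)).smulRight (φ i)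

section DiagOp

variable {κ : Type*} [Fintype κ] {φ : κ → H}

theorem diagOp_apply (c : κ → ℝ) (x : H) :
    diagOp φ c x = ∑ i, (c i * ⟪φ i, x⟫) • φ i := by
  simp [diagOp, smul_smul]

theorem inner_diagOp_self (c : κ → ℝ) (x : H) :
    (⟪diagOp φ c x, x⟫ : ℝ) = ∑ i, c i * ⟪φ i, x⟫ ^ 2 := by
  simp only [diagOp_apply, sum_inner, real_inner_smul_left]
  exact Finset.sum_congr rfl fun i _ => by ring

theorem IsPartialOrthonormal.inner_sum (hφ : IsPartialOrthonormal φ) (a : κ → ℝ) (i : κ) :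
    (⟪φ i, ∑ j, a j • φ j⟫ : ℝ) = a i * ⟪φ i, φ i⟫ := by
  rw [_root_.inner_sum, Finset.sum_eq_single i]
  · rw [real_inner_smul_right]
  · intro j _ hj
    rw [real_inner_smul_right, hφ.orthogonal i j hj.symm, mul_zero]
  · simp

theorem IsPartialOrthonormal.norm_sq_sum (hφ : IsPartialOrthonormal φ) (a : κ → ℝ) :
    ‖∑ j, a j • φ j‖ ^ 2 = ∑ j, a j ^ 2 * ⟪φ j, φ j⟫ := by
  rw [← real_inner_self_eq_norm_sq, sum_inner]
  refine Finset.sum_congr rfl fun i _ => ?_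
  rw [real_inner_smul_left, hφ.inner_sum]
  ring

/-- Bessel's inequality. -/
theorem IsPartialOrthonormal.sum_sq_inner_le (hφ : IsPartialOrthonormal φ) (x : H) :
    ∑ i, (⟪φ i, x⟫ : ℝ) ^ 2 ≤ ‖x‖ ^ 2 := by
  have h0 := sq_nonneg ‖x - ∑ i, (⟪φ i, x⟫ : ℝ) • φ i‖
  have h1 : (⟪x, ∑ i, (⟪φ i, x⟫ : ℝ) • φ i⟫ : ℝ) = ∑ i, (⟪φ i, x⟫ : ℝ) ^ 2 := by
    rw [_root_.inner_sum]
    refine Finset.sum_congr rfl fun i _ => ?_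
    rw [real_inner_smul_right, real_inner_comm (φ i) x, sq]
  have h2 : ‖∑ i, (⟪φ i, x⟫ : ℝ) • φ i‖ ^ 2 = ∑ i, (⟪φ i, x⟫ : ℝ) ^ 2 := by
    rw [hφ.norm_sq_sum]
    refine Finset.sum_congr rfl fun i _ => ?_
    rw [sq, mul_assoc, hφ.inner_mul_inner_self]
  rw [norm_sub_sq_real, h1, h2] at h0
  linarith

theorem IsPartialOrthonormal.opNorm_diagOp_le (hφ : IsPartialOrthonormal φ) {c : κ → ℝ} {C : ℝ}
    (hC : 0 ≤ C) (hc : ∀ i, |c i| ≤ C) : ‖diagOp φ c‖ ≤ C := by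
  refine ContinuousLinearMap.opNorm_le_bound _ hC fun x => ?_
  refine le_of_sq_le_sq ?_ (mul_nonneg hC (norm_nonneg x))
  rw [diagOp_apply, hφ.norm_sq_sum, mul_pow]
  refine le_trans ?_ (mul_le_mul_of_nonneg_left (hφ.sum_sq_inner_le x) (sq_nonneg C))
  rw [Finset.mul_sum]
  refine Finset.sum_le_sum fun i _ => ?_
  have h1 : c i ^ 2 ≤ C ^ 2 := by
    rw [← sq_abs]
    exact pow_le_pow_left₀ (abs_nonneg _) (hc i) 2
  calc (c i * ⟪φ i, x⟫) ^ 2 * ⟪φ i, φ i⟫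
      = c i ^ 2 * (⟪φ i, x⟫ * (⟪φ i, x⟫ * ⟪φ i, φ i⟫)) := by ring
    _ = c i ^ 2 * ⟪φ i, x⟫ ^ 2 := by rw [hφ.inner_mul_inner_self, sq ⟪φ i, x⟫]
    _ ≤ C ^ 2 * ⟪φ i, x⟫ ^ 2 := mul_le_mul_of_nonneg_right h1 (sq_nonneg _)

theorem IsPartialOrthonormal.diagOp_mul (hφ : IsPartialOrthonormal φ) (c d : κ → ℝ) :
    diagOp φ c * diagOp φ d = diagOp φ (c * d) := by
  ext x
  rw [mul_apply_eq_comp, diagOp_apply, diagOp_apply d, diagOp_apply]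
  refine Finset.sum_congr rfl fun i _ => ?_
  rw [hφ.inner_sum, mul_assoc (d i), hφ.inner_mul_inner_self, Pi.mul_apply, mul_assoc]

theorem diagOp_sub (c d : κ → ℝ) : diagOp φ c - diagOp φ d = diagOp φ (c - d) := by
  simp [diagOp, sub_smul, Finset.sum_sub_distrib]

theorem projOp_eq_diagOp {n : ℕ} (φ : Fin n → H) (r : ℕ) :
    projOp φ r = diagOp φ fun i => if (i : ℕ) < r then 1 else 0 := by
  simp [projOp, diagOp, Finset.sum_filter, ite_smul]

end DiagOp

section Gram

variable {n : ℕ} {v : Fin n → H} {K V : Matrix (Fin n) (Fin n) ℝ} {lam : Fin n → ℝ}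

theorem inner_sum_eigenvector (hK : ∀ i j, K i j = ⟪v i, v j⟫) (hV : Vᵀ * V = 1)
    (heig : ∀ j, K.mulVec (fun i => V i j) = lam j • (fun i => V i j)) (j k : Fin n) :
    (⟪∑ i, V i j • v i, ∑ i, V i k • v i⟫ : ℝ) = if j = k then lam k else 0 := by
  have h1 : ∀ i, (⟪v i, ∑ l, V l k • v l⟫ : ℝ) = lam k * V i k := by
    intro i
    have h := congrFun (heig k) i
    simp only [Matrix.mulVec, dotProduct, Pi.smul_apply, smul_eq_mul] at h
    rw [← h, _root_.inner_sum]
    refine Finset.sum_congr rfl fun l _ => ?_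
    rw [real_inner_smul_right, hK, mul_comm]
  have h2 := congrFun (congrFun hV j) k
  rw [Matrix.mul_apply, Matrix.one_apply] at h2
  simp only [Matrix.transpose_apply] at h2
  rw [sum_inner]
  calc ∑ i, (⟪V i j • v i, ∑ l, V l k • v l⟫ : ℝ) = lam k * ∑ i, V i j * V i k := by
        rw [Finset.mul_sum]
        refine Finset.sum_congr rfl fun i _ => ?_
        rw [real_inner_smul_left, h1]
        ring
    _ = _ := by rw [h2]; split_ifs <;> simp

theorem gram_eigenvalue_nonneg (hK : ∀ i j, K i j = ⟪v i, v j⟫) (hV : Vᵀ * V = 1)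
    (heig : ∀ j, K.mulVec (fun i => V i j) = lam j • (fun i => V i j)) (j : Fin n) :
    0 ≤ lam j := by
  have h := inner_sum_eigenvector hK hV heig j j
  rw [if_pos rfl] at h
  exact h ▸ real_inner_self_nonneg

theorem inner_phiVec (hK : ∀ i j, K i j = ⟪v i, v j⟫) (hV : Vᵀ * V = 1)
    (heig : ∀ j, K.mulVec (fun i => V i j) = lam j • (fun i => V i j)) (j k : Fin n) :
    (⟪phiVec v lam V j, phiVec v lam V k⟫ : ℝ) =
      (√(lam j))⁻¹ * ((√(lam k))⁻¹ * if j = k then lam k else 0) := by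
  rw [phiVec, phiVec, real_inner_smul_left, real_inner_smul_right,
    inner_sum_eigenvector hK hV heig]

theorem inner_phiVec_self (hK : ∀ i j, K i j = ⟪v i, v j⟫) (hV : Vᵀ * V = 1)
    (heig : ∀ j, K.mulVec (fun i => V i j) = lam j • (fun i => V i j)) {j : Fin n}
    (hj : 0 < lam j) : (⟪phiVec v lam V j, phiVec v lam V j⟫ : ℝ) = 1 := by
  rw [inner_phiVec hK hV heig, if_pos rfl]
  have h := Real.sqrt_pos.mpr hj
  nth_rewrite 3 [← Real.mul_self_sqrt hj.le]
  field_simp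

theorem isPartialOrthonormal_phiVec (hK : ∀ i j, K i j = ⟪v i, v j⟫) (hV : Vᵀ * V = 1)
    (heig : ∀ j, K.mulVec (fun i => V i j) = lam j • (fun i => V i j)) :
    IsPartialOrthonormal (phiVec v lam V) where
  orthogonal i j hij := by rw [inner_phiVec hK hV heig, if_neg hij, mul_zero, mul_zero]
  unit_or_zero i := by
    rcases (gram_eigenvalue_nonneg hK hV heig i).eq_or_lt with h | h
    · exact Or.inr (by simp [phiVec, ← h])
    · exact Or.inl (inner_phiVec_self hK hV heig h)

theorem integralOp_eq_diagOp (hK : ∀ i j, K i j = ⟪v i, v j⟫) (hV : Vᵀ * V = 1)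
    (heig : ∀ j, K.mulVec (fun i => V i j) = lam j • (fun i => V i j)) :
    integralOp v = diagOp (phiVec v lam V) fun j => lam j / n := by
  have hV' : V * Vᵀ = 1 := mul_eq_one_comm.mp hV
  have hterm : ∀ (x : H) (j : Fin n),
      (lam j * ⟪phiVec v lam V j, x⟫) • phiVec v lam V j =
        (⟪∑ i, V i j • v i, x⟫ : ℝ) • ∑ i, V i j • v i := by
    intro x j
    rw [phiVec, real_inner_smul_left, smul_smul]
    rcases (gram_eigenvalue_nonneg hK hV heig j).eq_or_lt with h | h
    · have h0 : (∑ i, V i j • v i) = 0 := by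
        rw [← inner_self_eq_zero (𝕜 := ℝ), inner_sum_eigenvector hK hV heig, if_pos rfl, h]
      simp [h0]
    · congr 1
      have hs := Real.sqrt_pos.mpr h
      nth_rewrite 1 [← Real.mul_self_sqrt h.le]
      field_simp
  ext x
  rw [diagOp_apply]
  have hsum : ∑ j, (⟪∑ i, V i j • v i, x⟫ : ℝ) • ∑ i, V i j • v i = ∑ i, ⟪v i, x⟫ • v i := by
    calc ∑ j, (⟪∑ i, V i j • v i, x⟫ : ℝ) • ∑ i, V i j • v i
        = ∑ j, ∑ l, ∑ i, (V l j * V i j * ⟪v i, x⟫) • v l := by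
          refine Finset.sum_congr rfl fun j _ => ?_
          rw [Finset.smul_sum]
          refine Finset.sum_congr rfl fun l _ => ?_
          rw [sum_inner, smul_smul, ← Finset.sum_smul, Finset.sum_mul]
          congr 1
          refine Finset.sum_congr rfl fun i _ => ?_
          rw [real_inner_smul_left]
          ring
      _ = ∑ l, ∑ i, ∑ j, (V l j * V i j * ⟪v i, x⟫) • v l := by
          rw [Finset.sum_comm]
          exact Finset.sum_congr rfl fun l _ => Finset.sum_comm
      _ = ∑ l, ∑ i, ((1 : Matrix (Fin n) (Fin n) ℝ) l i * ⟪v i, x⟫) • v l := by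
          refine Finset.sum_congr rfl fun l _ => Finset.sum_congr rfl fun i _ => ?_
          rw [← hV', Matrix.mul_apply, Finset.sum_mul, Finset.sum_smul]
          rfl
      _ = ∑ i, ⟪v i, x⟫ • v i := by
          simp [Matrix.one_apply, ite_mul, ite_smul]
  simp only [integralOp, _root_.smul_apply, _root_.sum_apply,
    ContinuousLinearMap.smulRight_apply, innerSL_apply_apply]
  rw [← hsum, Finset.smul_sum]
  refine Finset.sum_congr rfl fun j _ => ?_
  rw [← hterm, smul_smul]
  congr 1
  ring

end Gram

/-- Weyl's inequality for the eigenvalues of diagonal operators. -/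
theorem weyl_diagOp {n m : ℕ} {φ : Fin n → H} {ψ : Fin m → H} (hφ : IsPartialOrthonormal φ)
    (hψ : IsPartialOrthonormal ψ) {c : Fin n → ℝ} {d : Fin m → ℝ}
    (J : Fin m) (hψ1 : ∀ j ≤ J, (⟪ψ j, ψ j⟫ : ℝ) = 1) {s t : ℝ} (hs : 0 ≤ s)
    (ht : ∀ j ≤ J, t ≤ d j) (hcs : ∀ i : Fin n, (J : ℕ) ≤ i → c i ≤ s) :
    t ≤ s + ‖diagOp φ c - diagOp ψ d‖ := by
  classical
  let T : ({j : Fin m // j ≤ J} → ℝ) →ₗ[ℝ] H := Fintype.linearCombination ℝ fun j => ψ j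
  let F : ({j : Fin m // j ≤ J} → ℝ) →ₗ[ℝ] ({i : Fin n // (i : ℕ) < J} → ℝ) :=
    LinearMap.pi fun i => (innerSL ℝ (φ i)).toLinearMap ∘ₗ T
  have hker : LinearMap.ker F ≠ ⊥ := by
    apply LinearMap.ker_ne_bot_of_finrank_lt
    rw [Module.finrank_fintype_fun_eq_card, Module.finrank_fintype_fun_eq_card]
    have h1 : Fintype.card {i : Fin n // (i : ℕ) < J} ≤ J := by
      simpa using Fintype.card_le_of_injective
        (fun i : {i : Fin n // (i : ℕ) < J} => (⟨i, i.2⟩ : Fin J))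
        (fun a b hab => Subtype.ext (Fin.ext (by simpa using hab)))
    have h2 : (J : ℕ) + 1 ≤ Fintype.card {j : Fin m // j ≤ J} := by
      simpa using Fintype.card_le_of_injective
        (fun i : Fin (J + 1) =>
          (⟨⟨i, by omega⟩, Fin.le_def.mpr (Nat.lt_succ_iff.mp i.2)⟩ : {j : Fin m // j ≤ J}))
        (fun a b hab => Fin.ext (by simpa using hab))
    omega
  obtain ⟨y, hy, hy0⟩ := Submodule.exists_mem_ne_zero_of_ne_bot hker
  set x := T y with hx
  let z : Fin m → ℝ := fun j => if h : j ≤ J then y ⟨j, h⟩ else 0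
  have hz0 : ∀ j, ¬ j ≤ J → z j = 0 := fun j hj => dif_neg hj
  have hxz : x = ∑ j, z j • ψ j := by
    have h : ∑ j, z j • ψ j = ∑ j ∈ Finset.univ.filter (· ≤ J), z j • ψ j := by
      symm
      apply Finset.sum_subset (Finset.filter_subset _ _)
      intro j _ hj
      rw [hz0 j (by simpa using hj), zero_smul]
    rw [h, Finset.sum_subtype (p := (· ≤ J)) _ (by simp)]
    simp only [hx, T, Fintype.linearCombination_apply]
    refine Finset.sum_congr rfl fun j _ => ?_
    simp [z, j.2]
  have hinner : ∀ j, (⟪ψ j, x⟫ : ℝ) = z j := by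
    intro j
    rw [hxz, hψ.inner_sum]
    by_cases hj : j ≤ J
    · rw [hψ1 j hj, mul_one]
    · rw [hz0 j hj, zero_mul]
  have hnorm : ‖x‖ ^ 2 = ∑ j, z j ^ 2 := by
    rw [hxz, hψ.norm_sq_sum]
    refine Finset.sum_congr rfl fun j _ => ?_
    by_cases hj : j ≤ J
    · rw [hψ1 j hj, mul_one]
    · simp [hz0 j hj]
  have hpos : 0 < ‖x‖ ^ 2 := by
    obtain ⟨j, hj⟩ := Function.ne_iff.mp hy0
    rw [hnorm]
    refine Finset.sum_pos' (fun j _ => sq_nonneg _) ⟨j, Finset.mem_univ _, ?_⟩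
    have : z j = y j := by simp [z, j.2]
    rw [this]
    exact sq_pos_of_ne_zero hj
  have hB : t * ‖x‖ ^ 2 ≤ ⟪diagOp ψ d x, x⟫ := by
    rw [inner_diagOp_self, hnorm, Finset.mul_sum]
    refine Finset.sum_le_sum fun j _ => ?_
    rw [hinner]
    by_cases hj : j ≤ J
    · exact mul_le_mul_of_nonneg_right (ht j hj) (sq_nonneg _)
    · simp [hz0 j hj]
  have hA : (⟪diagOp φ c x, x⟫ : ℝ) ≤ s * ‖x‖ ^ 2 := by
    rw [inner_diagOp_self]
    refine le_trans ?_ (mul_le_mul_of_nonneg_left (hφ.sum_sq_inner_le x) hs)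
    rw [Finset.mul_sum]
    refine Finset.sum_le_sum fun i _ => ?_
    by_cases hi : (i : ℕ) < J
    · have : (⟪φ i, x⟫ : ℝ) = 0 := congrFun (LinearMap.mem_ker.mp hy) ⟨i, hi⟩
      simp [this]
    · exact mul_le_mul_of_nonneg_right (hcs i (not_lt.mp hi)) (sq_nonneg _)
  have hE : (⟪diagOp ψ d x, x⟫ : ℝ) - ⟪diagOp φ c x, x⟫ ≤
      ‖diagOp φ c - diagOp ψ d‖ * ‖x‖ ^ 2 := by
    rw [← inner_sub_left, ← _root_.sub_apply, norm_sub_rev]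
    calc _ ≤ ‖(diagOp ψ d - diagOp φ c) x‖ * ‖x‖ := real_inner_le_norm _ _
      _ ≤ ‖diagOp ψ d - diagOp φ c‖ * ‖x‖ * ‖x‖ :=
        mul_le_mul_of_nonneg_right (ContinuousLinearMap.le_opNorm _ _) (norm_nonneg _)
      _ = _ := by ring
  refine le_of_mul_le_mul_right ?_ hpos
  linarith

/-- A bound for the solution of the Sylvester equation behind the Davis–Kahan theorem. -/
theorem norm_le_of_sylvester {R : Type*} [NormedRing R] {X S E G M : R} {a β ε g : ℝ}
    (ha : 0 < a) (hG : ‖G‖ ≤ a⁻¹) (hM : ‖M‖ ≤ β) (hE : ‖E‖ ≤ ε) (hS : ‖S‖ ≤ 2)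
    (hg : 0 < g) (hgap : g ≤ a - β)
    (hX : ‖X‖ ≤ ‖S‖ * ‖E‖ * ‖G‖ + ‖M‖ * ‖X‖ * ‖G‖) :
    ‖X‖ ≤ 2 * ε / g := by
  have h1 : ‖X‖ ≤ 2 * ε * a⁻¹ + β * ‖X‖ * a⁻¹ := by
    have hβ := (norm_nonneg M).trans hM
    have hε := (norm_nonneg E).trans hE
    exact hX.trans (by gcongr)
  have h2 : a * ‖X‖ ≤ 2 * ε + β * ‖X‖ := by
    calc a * ‖X‖ ≤ a * (2 * ε * a⁻¹ + β * ‖X‖ * a⁻¹) := mul_le_mul_of_nonneg_left h1 ha.le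
      _ = _ := by field_simp
  rw [le_div_iff₀ hg]
  nlinarith [norm_nonneg X]

section DavisKahan

variable {n m : ℕ} {φ : Fin n → H} {ψ : Fin m → H}

theorem IsPartialOrthonormal.opNorm_one_sub_projOp_le (hφ : IsPartialOrthonormal φ) (r : ℕ) :
    ‖1 - projOp φ r‖ ≤ 2 := by
  have h1 : ‖(1 : H →L[ℝ] H)‖ ≤ 1 := ContinuousLinearMap.norm_id_le
  have h2 : ‖projOp φ r‖ ≤ 1 := by
    rw [projOp_eq_diagOp]
    refine hφ.opNorm_diagOp_le zero_le_one fun i => ?_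
    split_ifs <;> simp
  linarith [norm_sub_le (1 : H →L[ℝ] H) (projOp φ r)]

theorem IsPartialOrthonormal.projOp_commute_diagOp (hφ : IsPartialOrthonormal φ) (r : ℕ)
    (c : Fin n → ℝ) : projOp φ r * diagOp φ c = diagOp φ c * projOp φ r := by
  rw [projOp_eq_diagOp, hφ.diagOp_mul, hφ.diagOp_mul, mul_comm]

theorem IsPartialOrthonormal.opNorm_diagOp_mul_one_sub_projOp_le (hφ : IsPartialOrthonormal φ)
    {r : ℕ} {c : Fin n → ℝ} (hc : ∀ i, 0 ≤ c i) {β : ℝ} (hβ : 0 ≤ β)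
    (hcβ : ∀ i : Fin n, r ≤ i → c i ≤ β) : ‖diagOp φ c * (1 - projOp φ r)‖ ≤ β := by
  rw [mul_sub, mul_one, projOp_eq_diagOp, hφ.diagOp_mul, diagOp_sub]
  refine hφ.opNorm_diagOp_le hβ fun i => ?_
  by_cases hi : (i : ℕ) < r
  · simpa [hi] using hβ
  · simpa [hi, abs_of_nonneg (hc i)] using hcβ i (not_lt.mp hi)

theorem IsPartialOrthonormal.exists_partial_inverse (hφ : IsPartialOrthonormal φ) {r : ℕ}
    {c : Fin n → ℝ} {a : ℝ} (ha : 0 < a) (hca : ∀ i : Fin n, (i : ℕ) < r → a ≤ c i) :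
    ∃ G : H →L[ℝ] H, ‖G‖ ≤ a⁻¹ ∧ diagOp φ c * G = projOp φ r ∧ G * diagOp φ c = projOp φ r ∧
      projOp φ r * G = G ∧ G * projOp φ r = G := by
  have hinv : ∀ i : Fin n, c i * (if (i : ℕ) < r then (c i)⁻¹ else 0) =
      if (i : ℕ) < r then 1 else 0 := by
    intro i
    split_ifs with hi
    · exact mul_inv_cancel₀ (ha.trans_le (hca i hi)).ne'
    · simp
  refine ⟨diagOp φ fun i => if (i : ℕ) < r then (c i)⁻¹ else 0, ?_, ?_, ?_, ?_, ?_⟩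
  · refine hφ.opNorm_diagOp_le (inv_nonneg.mpr ha.le) fun i => ?_
    split_ifs with hi
    · rw [abs_of_pos (inv_pos.mpr (ha.trans_le (hca i hi)))]
      exact inv_anti₀ ha (hca i hi)
    · simpa using ha.le
  · rw [projOp_eq_diagOp, hφ.diagOp_mul]
    exact congrArg _ (funext hinv)
  · rw [projOp_eq_diagOp, hφ.diagOp_mul, mul_comm]
    exact congrArg _ (funext hinv)
  · rw [projOp_eq_diagOp, hφ.diagOp_mul]
    exact congrArg _ (funext fun i => by by_cases hi : (i : ℕ) < r <;> simp [hi])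
  · rw [projOp_eq_diagOp, hφ.diagOp_mul]
    exact congrArg _ (funext fun i => by by_cases hi : (i : ℕ) < r <;> simp [hi])

theorem IsPartialOrthonormal.projOp_mul_projOp (hφ : IsPartialOrthonormal φ) (r : ℕ) :
    projOp φ r * projOp φ r = projOp φ r := by
  rw [projOp_eq_diagOp, hφ.diagOp_mul]
  exact congrArg _ (funext fun i => by by_cases hi : (i : ℕ) < r <;> simp [hi])

/-- A Davis–Kahan bound: the eigenvalues of the first operator with index below `r` are at least
`a`, those of the second with index at least `r` are at most `β < a`. -/
theorem opNorm_projOp_one_sub_projOp_le (hφ : IsPartialOrthonormal φ)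
    (hψ : IsPartialOrthonormal ψ) {c : Fin n → ℝ} {d : Fin m → ℝ} {r : ℕ} {a β ε g : ℝ}
    (ha : 0 < a) (hca : ∀ i : Fin n, (i : ℕ) < r → a ≤ c i) (hd : ∀ j, 0 ≤ d j) (hβ : 0 ≤ β)
    (hdβ : ∀ j : Fin m, r ≤ j → d j ≤ β) (hE : ‖diagOp φ c - diagOp ψ d‖ ≤ ε)
    (hg : 0 < g) (hgap : g ≤ a - β) :
    ‖(1 - projOp ψ r) * projOp φ r‖ ≤ 2 * ε / g ∧
      ‖projOp φ r * (1 - projOp ψ r)‖ ≤ 2 * ε / g := by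
  obtain ⟨G, hG, hAG, hGA, hPG, hGP⟩ := hφ.exists_partial_inverse ha hca
  have hS := hψ.opNorm_one_sub_projOp_le r
  have hM := hψ.opNorm_diagOp_mul_one_sub_projOp_le hd hβ hdβ
  have hcomm : (1 - projOp ψ r) * diagOp ψ d = diagOp ψ d * (1 - projOp ψ r) := by
    rw [sub_mul, mul_sub, one_mul, mul_one, hψ.projOp_commute_diagOp]
  have hidem : (1 - projOp ψ r) * (1 - projOp ψ r) = 1 - projOp ψ r := by
    simp [mul_sub, sub_mul, hψ.projOp_mul_projOp]
  generalize projOp φ r = P at *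
  generalize 1 - projOp ψ r = S at *
  generalize diagOp φ c = A at *
  generalize diagOp ψ d = B at *
  refine ⟨norm_le_of_sylvester ha hG hM hE hS hg hgap ?_,
    norm_le_of_sylvester ha hG hM hE hS hg hgap ?_⟩
  · have hX : S * P = S * (A - B) * G + B * S * (S * P) * G := by
      calc S * P = S * (A - B) * G + S * B * G := by rw [← hAG]; noncomm_ring
        _ = S * (A - B) * G + B * (S * S) * (P * G) := by rw [hcomm, hidem, hPG]
        _ = _ := by noncomm_ring
    calc ‖S * P‖ = ‖S * (A - B) * G + B * S * (S * P) * G‖ := by rw [← hX]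
      _ ≤ _ := (norm_add_le _ _).trans (add_le_add norm_mul₃_le norm_mul₃_le)
  · have hX : P * S = G * (A - B) * S + G * (P * S) * (B * S) := by
      calc P * S = G * (A - B) * S + G * (B * S) := by rw [← hGA]; noncomm_ring
        _ = G * (A - B) * S + G * P * (S * B * S) := by rw [hcomm, hGP, mul_assoc B, hidem]
        _ = _ := by noncomm_ring
    calc ‖P * S‖ = ‖G * (A - B) * S + G * (P * S) * (B * S)‖ := by rw [← hX]
      _ ≤ ‖G‖ * ‖A - B‖ * ‖S‖ + ‖G‖ * ‖P * S‖ * ‖B * S‖ :=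
        (norm_add_le _ _).trans (add_le_add norm_mul₃_le norm_mul₃_le)
      _ = _ := by ring

end DavisKahan

end OperatorBounds

/-- if `K` is positive definite, `λ̂_r > 0` and the normalized eigengap
`Δ = (λ_r − λ_{r+1})/N` exceeds `3‖L_N − L_m‖_HS`, then the operator `ΔH = H_r − Ĥ_r`
satisfies `‖ΔH‖₂ ≤ 4‖L_N − L_m‖_HS/(Δ − ‖L_N − L_m‖_HS) ≤ 6‖L_N − L_m‖_HS/Δ`. -/
theorem nystrom_deltaH_opNorm_bound
    {H : Type*} [NormedAddCommGroup H] [InnerProductSpace ℝ H]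
    {ι : Type*} (b : HilbertBasis ι ℝ H)
    (N m r : ℕ) (hm : 0 < m) (hr1 : 1 ≤ r) (hrN : r < N) (hrm : r ≤ m)
    (v : Fin N → H)
    (K : Matrix (Fin N) (Fin N) ℝ) (hK : ∀ i j, K i j = ⟪v i, v j⟫)
    (hKpd : K.PosDef)
    (lam : Fin N → ℝ) (hdesc : ∀ i j : Fin N, i ≤ j → lam j ≤ lam i)
    (V : Matrix (Fin N) (Fin N) ℝ) (hV : Vᵀ * V = 1)
    (heig : ∀ j, K.mulVec (fun i => V i j) = lam j • (fun i => V i j))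
    (w : Fin m → H) (hw : ∀ a, ∃ i, w a = v i)
    (Khat : Matrix (Fin m) (Fin m) ℝ) (hKhat : ∀ a b, Khat a b = ⟪w a, w b⟫)
    (lamh : Fin m → ℝ) (hdesch : ∀ a b : Fin m, a ≤ b → lamh b ≤ lamh a)
    (U : Matrix (Fin m) (Fin m) ℝ) (hU : Uᵀ * U = 1)
    (heigh : ∀ j, Khat.mulVec (fun i => U i j) = lamh j • (fun i => U i j))
    (hlamh : 0 < lamh ⟨r - 1, by omega⟩)
    (ε : ℝ) (hε : ε = hsNorm b (integralOp v - integralOp w))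
    (Δ : ℝ) (hΔ : Δ = (lam ⟨r - 1, by omega⟩ - lam ⟨r, hrN⟩) / N)
    (hgap : Δ > 3 * ε) :
    ‖projOp (phiVec v lam V) r - projOp (phiVec w lamh U) r‖ ≤ 4 * ε / (Δ - ε) ∧
      4 * ε / (Δ - ε) ≤ 6 * ε / Δ := by
  have hφ := isPartialOrthonormal_phiVec hK hV heig
  have hψ := isPartialOrthonormal_phiVec hKhat hU heigh
  have hA := integralOp_eq_diagOp hK hV heig
  have hB := integralOp_eq_diagOp hKhat hU heigh
  have hE : ‖integralOp v - integralOp w‖ ≤ ε := hε ▸ opNorm_integralOp_sub_le_hsNorm b v w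
  have hε0 : 0 ≤ ε := (norm_nonneg _).trans hE
  rw [hA, hB] at hE
  have hE' := hE
  rw [norm_sub_rev] at hE'
  have hN0 : (0 : ℝ) < N := by exact_mod_cast (by omega : 0 < N)
  have hm0 : (0 : ℝ) < m := by exact_mod_cast hm
  have hlam := gram_eigenvalue_nonneg hK hV heig
  have hlamh0 := gram_eigenvalue_nonneg hKhat hU heigh
  have hc : ∀ i, 0 ≤ lam i / N := fun i => div_nonneg (hlam i) hN0.le
  have hd : ∀ j, 0 ≤ lamh j / m := fun j => div_nonneg (hlamh0 j) hm0.le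
  set p : Fin N := ⟨r - 1, by omega⟩ with hp
  set q : Fin N := ⟨r, hrN⟩ with hq
  set k : Fin m := ⟨r - 1, by omega⟩ with hk
  have hΔ' : Δ = lam p / N - lam q / N := by rw [hΔ, sub_div]
  have hg : 0 < Δ - ε := by linarith
  have hp0 : 0 < lam p / N := by linarith [hc q]
  have hlamp : 0 < lam p := (div_pos_iff_of_pos_right hN0).mp hp0
  have hk0 : 0 < lamh k / m := div_pos hlamh hm0
  have hcp : ∀ i ≤ p, lam p / N ≤ lam i / N := fun i hi =>
    div_le_div_of_nonneg_right (hdesc i p hi) hN0.le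
  have hcq : ∀ i : Fin N, r ≤ i → lam i / N ≤ lam q / N := fun i hi =>
    div_le_div_of_nonneg_right (hdesc q i hi) hN0.le
  have hdk : ∀ j ≤ k, lamh k / m ≤ lamh j / m := fun j hj =>
    div_le_div_of_nonneg_right (hdesch j k hj) hm0.le
  have hweyl_top : lam p / N ≤ lamh k / m + ε := by
    refine (weyl_diagOp hψ hφ p (fun i hi => ?_) (hd k) hcp fun j hj => ?_).trans
      (add_le_add_right hE' _)
    · exact inner_phiVec_self hK hV heig (hlamp.trans_le (hdesc i p hi))
    · exact div_le_div_of_nonneg_right (hdesch k j hj) hm0.le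
  have hweyl_bot : ∀ j : Fin m, r ≤ j → lamh j / m ≤ lam q / N + ε := by
    intro j hj
    rcases (hlamh0 j).eq_or_lt with h0 | h0
    · rw [← h0, zero_div]
      linarith [hc q]
    · refine (weyl_diagOp hφ hψ j (fun i hi => ?_) (hc q) (fun i hi => ?_)
        fun i hi => hcq i (hj.trans hi)).trans (add_le_add_right hE _)
      · exact inner_phiVec_self hKhat hU heigh (h0.trans_le (hdesch i j hi))
      · exact div_le_div_of_nonneg_right (hdesch i j hi) hm0.le
  have hX := (opNorm_projOp_one_sub_projOp_le hφ hψ (r := r) hp0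
    (fun i hi => hcp i (Fin.le_def.mpr (by simp only [hp]; omega))) hd
    (add_nonneg (hc q) hε0) hweyl_bot hE hg (by linarith)).1
  have hY := (opNorm_projOp_one_sub_projOp_le hψ hφ (r := r) hk0
    (fun j hj => hdk j (Fin.le_def.mpr (by simp only [hk]; omega))) hc
    (hc q) hcq hE' hg (by linarith)).2
  constructor
  · set P := projOp (phiVec v lam V) r
    set Q := projOp (phiVec w lamh U) r
    calc ‖P - Q‖ = ‖(1 - Q) * P - Q * (1 - P)‖ := by congr 1; noncomm_ring
      _ ≤ ‖(1 - Q) * P‖ + ‖Q * (1 - P)‖ := norm_sub_le _ _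
      _ ≤ 2 * ε / (Δ - ε) + 2 * ε / (Δ - ε) := add_le_add hX hY
      _ = 4 * ε / (Δ - ε) := by ring
  · rw [div_le_div_iff₀ hg (by linarith)]
    nlinarith [mul_nonneg hε0 (by linarith : (0 : ℝ) ≤ Δ - 3 * ε)]
end
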